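/- Let A = k[x,y] be a polynomial ring over a field k, and let N be the cokernel of the A-linear map φ : A³ → A² given by the matrix [[xy, y³, x⁷], [0, 0, −y²]]. Then N is an indecomposable A-module, the kernel of φ is the free A-module generated by (y², −x, 0), and the total Betti numbers of N over A are β_0 = 2, β_1 = 3, β_2 = 1, so that Σ_i β_i^N = 6. -/

import Mathlib

noncomputable section

namespace DGPaper

variable (k : Type) [Field k]

/-- The `A`-linear map `φ : A³ → A²` over `A = k[x,y]` given by the matrix
`[[xy, y³, x⁷], [0, 0, −y²]]`. -/
noncomputable def phiMap :
    (Fin 3 → MvPolynomial (Fin 2) k) →ₗ[MvPolynomial (Fin 2) k]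
      (Fin 2 → MvPolynomial (Fin 2) k) :=
  Matrix.toLin'
    !![MvPolynomial.X 0 * MvPolynomial.X 1, MvPolynomial.X 1 ^ 3, MvPolynomial.X 0 ^ 7;
       0, 0, -(MvPolynomial.X 1 ^ 2)]

/-- `N = coker φ`. -/
noncomputable def cokerN : Type :=
  (Fin 2 → MvPolynomial (Fin 2) k) ⧸ LinearMap.range (phiMap k)

noncomputable instance : AddCommGroup (cokerN k) := by
  unfold cokerN; infer_instance

noncomputable instance : Module (MvPolynomial (Fin 2) k) (cokerN k) := by
  unfold cokerN; infer_instance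

/-- The element `(y², −x, 0) ∈ A³`. -/
noncomputable def kerGen : Fin 3 → MvPolynomial (Fin 2) k :=
  ![MvPolynomial.X 1 ^ 2, -MvPolynomial.X 0, 0]

/-- The map `ψ : A → A³`, `a ↦ a·(y², −x, 0)`. -/
noncomputable def psiMap :
    MvPolynomial (Fin 2) k →ₗ[MvPolynomial (Fin 2) k] (Fin 3 → MvPolynomial (Fin 2) k) :=
  LinearMap.toSpanSingleton _ _ (kerGen k)

open MvPolynomial in
theorem aux_phi (v : Fin 3 → MvPolynomial (Fin 2) k) :
    phiMap k v = ![X 0 * X 1 * v 0 + X 1 ^ 3 * v 1 + X 0 ^ 7 * v 2, -(X 1 ^ 2 * v 2)] := by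
  ext1 i
  fin_cases i <;> simp [phiMap, Matrix.mulVec, dotProduct, Fin.sum_univ_three]

open MvPolynomial in
theorem aux_decomp (r : MvPolynomial (Fin 2) k) :
    ∃ (c : k) (s t : MvPolynomial (Fin 2) k), r = C c + X 0 * s + X 1 * t := by
  induction r using MvPolynomial.induction_on with
  | C a => exact ⟨a, 0, 0, by simp⟩
  | add p q hp hq =>
    obtain ⟨c, s, t, rfl⟩ := hp
    obtain ⟨c', s', t', rfl⟩ := hq
    exact ⟨c + c', s + s', t + t', by rw [C_add]; ring⟩
  | mul_X p i hp =>
    fin_cases i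
    · exact ⟨0, p, 0, by simp [mul_comm]⟩
    · exact ⟨0, 0, p, by simp [mul_comm]⟩

/-- The quotient map. -/
def auxMk : (Fin 2 → MvPolynomial (Fin 2) k) →ₗ[MvPolynomial (Fin 2) k] cokerN k :=
  Submodule.mkQ (LinearMap.range (phiMap k))

theorem auxMk_surj : Function.Surjective (auxMk k) :=
  Submodule.mkQ_surjective (LinearMap.range (phiMap k))

theorem auxMk_eq_zero (v : Fin 2 → MvPolynomial (Fin 2) k) :
    auxMk k v = 0 ↔ v ∈ LinearMap.range (phiMap k) :=
  Submodule.Quotient.mk_eq_zero (LinearMap.range (phiMap k))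

/-- The class of `p e₁ + q e₂`. -/
def auxE (p q : MvPolynomial (Fin 2) k) : cokerN k := auxMk k ![p, q]

theorem auxE_surj (n : cokerN k) : ∃ p q, n = auxE k p q := by
  obtain ⟨v, rfl⟩ := auxMk_surj k n
  refine ⟨v 0, v 1, ?_⟩
  unfold auxE
  congr 1
  ext1 i
  fin_cases i <;> rfl

theorem auxE_smul (a p q : MvPolynomial (Fin 2) k) :
    a • auxE k p q = auxE k (a * p) (a * q) := by
  unfold auxE
  rw [← map_smul]
  simp

open MvPolynomial in
theorem auxE_zero_iff (p q : MvPolynomial (Fin 2) k) :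
    auxE k p q = 0 ↔ ∃ a b c, p = X 0 * X 1 * a + X 1 ^ 3 * b + X 0 ^ 7 * c ∧
      q = -(X 1 ^ 2 * c) := by
  unfold auxE
  rw [auxMk_eq_zero]
  constructor
  · rintro ⟨v, hv⟩
    rw [aux_phi] at hv
    exact ⟨v 0, v 1, v 2, by simpa using (congrFun hv 0).symm,
      by simpa using (congrFun hv 1).symm⟩
  · rintro ⟨a, b, c, rfl, rfl⟩
    exact ⟨![a, b, c], by rw [aux_phi]; simp⟩

open MvPolynomial in
theorem auxE_eq {p q p' q' : MvPolynomial (Fin 2) k} (a b c : MvPolynomial (Fin 2) k)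
    (h1 : p - p' = X 0 * X 1 * a + X 1 ^ 3 * b + X 0 ^ 7 * c)
    (h2 : q - q' = -(X 1 ^ 2 * c)) : auxE k p q = auxE k p' q' := by
  have h : auxE k (p - p') (q - q') = 0 := (auxE_zero_iff k _ _).2 ⟨a, b, c, h1, h2⟩
  have h' : auxE k (p - p') (q - q') = auxE k p q - auxE k p' q' := by
    unfold auxE
    rw [← map_sub]
    simp
  rw [h'] at h
  exact sub_eq_zero.1 h

open MvPolynomial in
theorem aux_prime (i : Fin 2) : Prime (X i : MvPolynomial (Fin 2) k) :=
  MvPolynomial.X_prime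

open MvPolynomial in
theorem aux_nd01 : ¬ (X 0 : MvPolynomial (Fin 2) k) ∣ X 1 := by
  rw [MvPolynomial.X_dvd_X]; simp

open MvPolynomial in
theorem aux_nd10 : ¬ (X 1 : MvPolynomial (Fin 2) k) ∣ X 0 := by
  rw [MvPolynomial.X_dvd_X]; simp

open MvPolynomial in
theorem auxE_ne {g : MvPolynomial (Fin 2) k} (hg : ¬ X 1 ∣ g) : auxE k g 0 ≠ 0 := by
  intro h
  obtain ⟨a, b, c, h1, h2⟩ := (auxE_zero_iff k _ _).1 h
  have hc : c = 0 := by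
    have := (mul_eq_zero.1 (neg_eq_zero.1 h2.symm))
    exact this.resolve_left (pow_ne_zero _ (aux_prime k 1).ne_zero)
  subst hc
  exact hg ⟨X 0 * a + X 1 ^ 2 * b, by rw [h1]; ring⟩

open MvPolynomial in
theorem auxE_y2_ne : auxE k (X 1 ^ 2) 0 ≠ 0 := by
  intro h
  obtain ⟨a, b, c, h1, h2⟩ := (auxE_zero_iff k _ _).1 h
  have hc : c = 0 := by
    have := (mul_eq_zero.1 (neg_eq_zero.1 h2.symm))
    exact this.resolve_left (pow_ne_zero _ (aux_prime k 1).ne_zero)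
  subst hc
  have h3 : X 1 * (1 - X 1 * b) = X 0 * a :=
    mul_left_cancel₀ (aux_prime k 1).ne_zero (by linear_combination h1)
  have h4 : (X 0 : MvPolynomial (Fin 2) k) ∣ X 1 * (1 - X 1 * b) := ⟨a, h3⟩
  obtain ⟨d, hd⟩ := ((aux_prime k 0).dvd_or_dvd h4).resolve_left (aux_nd01 k)
  have := congrArg (constantCoeff) hd
  simp at this

open MvPolynomial in
theorem aux_cases (n : cokerN k) :
    (∃ r, n = auxE k (X 1 * r) 0) ∨ ∃ a g : MvPolynomial (Fin 2) k, ¬ X 1 ∣ g ∧ a • n = auxE k g 0 := by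
  obtain ⟨p, q, rfl⟩ := auxE_surj k n
  have hy := aux_prime k 1
  have hx8 : ∀ q : MvPolynomial (Fin 2) k, ¬ X 1 ∣ q → ¬ X 1 ∣ X 0 ^ 8 * q := by
    intro q hq h
    rcases hy.dvd_or_dvd h with h | h
    · exact aux_nd10 k (hy.dvd_of_dvd_pow h)
    · exact hq h
  by_cases h1 : X 1 ∣ q
  · obtain ⟨q, rfl⟩ := h1
    by_cases h2 : X 1 ∣ q
    · obtain ⟨q, rfl⟩ := h2
      have e : auxE k p (X 1 * (X 1 * q)) = auxE k (p + X 0 ^ 7 * q) 0 :=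
        auxE_eq k 0 0 (-q) (by ring) (by ring)
      rw [e]
      by_cases h3 : X 1 ∣ p + X 0 ^ 7 * q
      · obtain ⟨r, hr⟩ := h3
        exact Or.inl ⟨r, by rw [hr]⟩
      · exact Or.inr ⟨1, _, h3, one_smul _ _⟩
    · refine Or.inr ⟨X 0 * X 1, X 0 ^ 8 * q, hx8 q h2, ?_⟩
      rw [auxE_smul]
      exact auxE_eq k p 0 (-(X 0 * q)) (by ring) (by ring)
  · refine Or.inr ⟨X 0 * X 1 ^ 2, X 0 ^ 8 * q, hx8 q h1, ?_⟩
    rw [auxE_smul]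
    exact auxE_eq k (X 1 * p) 0 (-(X 0 * q)) (by ring) (by ring)

open MvPolynomial in
theorem aux_socle (V : Submodule (MvPolynomial (Fin 2) k) (cokerN k))
    (r : MvPolynomial (Fin 2) k) (hm : auxE k (X 1 * r) 0 ∈ V)
    (h0 : auxE k (X 1 * r) 0 ≠ 0) : auxE k (X 1 ^ 2) 0 ∈ V := by
  have key : ∀ c : k, c ≠ 0 → auxE k (C c * X 1 ^ 2) 0 ∈ V → auxE k (X 1 ^ 2) 0 ∈ V := by
    intro c hc h
    have := V.smul_mem (C c⁻¹) h
    rwa [auxE_smul, ← mul_assoc, ← C_mul, inv_mul_cancel₀ hc, C_1, one_mul, mul_zero] at this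
  obtain ⟨c, s, t, rfl⟩ := aux_decomp k r
  by_cases hc : c = 0
  · subst hc
    obtain ⟨c, s', t, rfl⟩ := aux_decomp k t
    have e : auxE k (X 1 * (C 0 + X 0 * s + X 1 * (C c + X 0 * s' + X 1 * t))) 0 =
        auxE k (C c * X 1 ^ 2) 0 :=
      auxE_eq k (s + X 1 * s') t 0 (by rw [C_0]; ring) (by ring)
    rw [e] at hm h0
    by_cases hc : c = 0
    · subst hc
      exact absurd ((auxE_zero_iff k _ _).2 ⟨0, 0, 0, by simp, by simp⟩) h0
    · exact key c hc hm
  · refine key c hc ?_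
    have := V.smul_mem (X 1) hm
    rw [auxE_smul] at this
    have e : auxE k (X 1 * (X 1 * (C c + X 0 * s + X 1 * t))) (X 1 * 0) =
        auxE k (C c * X 1 ^ 2) 0 :=
      auxE_eq k (X 1 * s) t 0 (by ring) (by ring)
    rwa [e] at this

open MvPolynomial in
theorem aux_tors (U V : Submodule (MvPolynomial (Fin 2) k) (cokerN k)) (h : IsCompl U V)
    (hV : ∀ n ∈ V, ∃ r, n = auxE k (X 1 * r) 0) : V = ⊥ := by
  by_contra hne
  obtain ⟨n, hn, hn0⟩ := Submodule.exists_mem_ne_zero_of_ne_bot hne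
  obtain ⟨r, rfl⟩ := hV n hn
  have h1 := aux_socle k V r hn hn0
  have h2 : auxE k 1 0 ∈ U ⊔ V := by rw [h.sup_eq_top]; trivial
  obtain ⟨u, hu, v, hv, huv⟩ := Submodule.mem_sup.1 h2
  obtain ⟨r', rfl⟩ := hV v hv
  have h3 : (X 1 ^ 2 : MvPolynomial (Fin 2) k) • auxE k (X 1 * r') 0 = 0 := by
    rw [auxE_smul]
    exact (auxE_zero_iff k _ _).2 ⟨0, r', 0, by ring, by ring⟩
  have h4 := congrArg (fun z => (X 1 ^ 2 : MvPolynomial (Fin 2) k) • z) huv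
  simp only [smul_add, h3, add_zero] at h4
  rw [auxE_smul, mul_one, mul_zero] at h4
  have h5 := U.smul_mem (X 1 ^ 2) hu
  rw [h4] at h5
  exact auxE_y2_ne k (Submodule.disjoint_def.1 h.disjoint _ h5 h1)

open MvPolynomial in
theorem aux_indec (U V : Submodule (MvPolynomial (Fin 2) k) (cokerN k)) (h : IsCompl U V) :
    U = ⊥ ∨ V = ⊥ := by
  by_cases hU : ∀ n ∈ U, ∃ r, n = auxE k (X 1 * r) 0
  · exact Or.inl (aux_tors k V U h.symm hU)
  by_cases hV : ∀ n ∈ V, ∃ r, n = auxE k (X 1 * r) 0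
  · exact Or.inr (aux_tors k U V h hV)
  exfalso
  push Not at hU hV
  obtain ⟨n, hn, hn'⟩ := hU
  obtain ⟨m, hm, hm'⟩ := hV
  obtain ⟨a, g, hg, hag⟩ := (aux_cases k n).resolve_left (fun ⟨r, hr⟩ => hn' r hr)
  obtain ⟨b, g', hg', hbg⟩ := (aux_cases k m).resolve_left (fun ⟨r, hr⟩ => hm' r hr)
  have h1 := U.smul_mem g' (U.smul_mem a hn)
  have h2 := V.smul_mem g (V.smul_mem b hm)
  rw [hag, auxE_smul, mul_zero] at h1
  rw [hbg, auxE_smul, mul_zero, mul_comm] at h2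
  refine auxE_ne k ?_ (Submodule.disjoint_def.1 h.disjoint _ h1 h2)
  intro hd
  exact ((aux_prime k 1).dvd_or_dvd hd).elim hg' hg

open MvPolynomial in
theorem aux_ker : LinearMap.ker (phiMap k) =
    Submodule.span (MvPolynomial (Fin 2) k) {kerGen k} := by
  have hy := (aux_prime k 1).ne_zero
  have hx := (aux_prime k 0).ne_zero
  ext v
  rw [LinearMap.mem_ker, Submodule.mem_span_singleton, aux_phi]
  constructor
  · intro hv
    have h1 := congrFun hv 0
    have h2 := congrFun hv 1
    simp only [Matrix.cons_val_zero, Matrix.cons_val_one, Pi.zero_apply, neg_eq_zero] at h1 h2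
    have hc : v 2 = 0 := (mul_eq_zero.1 h2).resolve_left (pow_ne_zero _ hy)
    rw [hc] at h1
    have h3 : X 0 * v 0 = - (X 1 ^ 2 * v 1) :=
      mul_left_cancel₀ hy (by linear_combination h1)
    have h4 : X 0 ∣ X 1 ^ 2 * v 1 := ⟨-v 0, by linear_combination h3⟩
    obtain ⟨d, hd⟩ := ((aux_prime k 0).dvd_or_dvd h4).resolve_left
      (fun h => aux_nd01 k ((aux_prime k 0).dvd_of_dvd_pow h))
    have h0 : v 0 = - (X 1 ^ 2 * d) :=
      mul_left_cancel₀ hx (by rw [h3, hd]; ring)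
    refine ⟨-d, ?_⟩
    ext1 i
    fin_cases i
    · simp [kerGen, h0, mul_comm]
    · simp [kerGen, hd, mul_comm]
    · simp [kerGen, hc]
  · rintro ⟨a, rfl⟩
    ext1 i
    fin_cases i
    · simp [kerGen]; ring
    · simp [kerGen]

theorem aux_mem_smul {ι : Type} [Fintype ι] [DecidableEq ι] {R : Type} [CommRing R] (I : Ideal R)
    (v : ι → R) (h : ∀ i, v i ∈ I) : v ∈ I • (⊤ : Submodule R (ι → R)) := by
  rw [pi_eq_sum_univ' v]
  exact Submodule.sum_mem _ fun i _ => Submodule.smul_mem_smul (h i) trivial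

/-- STATEMENT 12 (from the proof of Theorem 2.1.1): for `A = k[x,y]` and
`N = coker φ` with `φ = [[xy, y³, x⁷], [0, 0, −y²]] : A³ → A²`:  `N` is
indecomposable; `ker φ` is the free `A`-module generated by `(y², −x, 0)`; and
`0 → A → A³ → A² → N → 0` (via `ψ = (y², −x, 0)` and `φ`) is a minimal free
resolution of `N`, so that the total Betti numbers of `N` are `β₀ = 2`, `β₁ = 3`,
`β₂ = 1`, whence `Σᵢ βᵢ = 2 + 3 + 1 = 6`. -/
theorem coker_indecomposable_kernel_free_betti :
    -- `N` is an indecomposable `A`-module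
    ((∃ n : cokerN k, n ≠ 0) ∧
      ∀ U V : Submodule (MvPolynomial (Fin 2) k) (cokerN k),
        IsCompl U V → U = ⊥ ∨ V = ⊥) ∧
    -- the kernel of `φ` is the free `A`-module generated by `(y², −x, 0)`
    LinearMap.ker (phiMap k) =
      Submodule.span (MvPolynomial (Fin 2) k) {kerGen k} ∧
    (∀ a : MvPolynomial (Fin 2) k, a • kerGen k = 0 → a = 0) ∧
    -- `0 → A → A³ → A² → N → 0` is exact …
    Function.Injective (psiMap k) ∧
    LinearMap.range (psiMap k) = LinearMap.ker (phiMap k) ∧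
    -- … and minimal (entries of the differentials lie in the maximal ideal `(x,y)`),
    -- exhibiting the total Betti numbers `β₀ = 2`, `β₁ = 3`, `β₂ = 1`
    LinearMap.range (phiMap k) ≤
      (Ideal.span {MvPolynomial.X 0, MvPolynomial.X 1} : Ideal (MvPolynomial (Fin 2) k)) •
        (⊤ : Submodule (MvPolynomial (Fin 2) k) (Fin 2 → MvPolynomial (Fin 2) k)) ∧
    LinearMap.range (psiMap k) ≤
      (Ideal.span {MvPolynomial.X 0, MvPolynomial.X 1} : Ideal (MvPolynomial (Fin 2) k)) •
        (⊤ : Submodule (MvPolynomial (Fin 2) k) (Fin 3 → MvPolynomial (Fin 2) k)) ∧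
    (2 + 3 + 1 : ℕ) = 6 := by
  have hfree : ∀ a : MvPolynomial (Fin 2) k, a • kerGen k = 0 → a = 0 := by
    intro a ha
    have := congrFun ha 1
    simpa [kerGen] using this
  have hr : LinearMap.range (psiMap k) =
      Submodule.span (MvPolynomial (Fin 2) k) {kerGen k} :=
    LinearMap.range_toSpanSingleton _
  have hx : (MvPolynomial.X 0 : MvPolynomial (Fin 2) k) ∈
      (Ideal.span {MvPolynomial.X 0, MvPolynomial.X 1} : Ideal (MvPolynomial (Fin 2) k)) :=
    Ideal.subset_span (by simp)
  have hy : (MvPolynomial.X 1 : MvPolynomial (Fin 2) k) ∈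
      (Ideal.span {MvPolynomial.X 0, MvPolynomial.X 1} : Ideal (MvPolynomial (Fin 2) k)) :=
    Ideal.subset_span (by simp)
  refine ⟨⟨⟨_, auxE_y2_ne k⟩, aux_indec k⟩, aux_ker k, hfree, ?_, ?_, ?_, ?_, rfl⟩
  · rw [injective_iff_map_eq_zero]
    intro a ha
    exact hfree a ha
  · rw [hr, aux_ker]
  · rintro _ ⟨v, rfl⟩
    apply aux_mem_smul
    rw [aux_phi]
    intro i
    fin_cases i
    · exact add_mem (add_mem (Ideal.mul_mem_right _ _ (Ideal.mul_mem_left _ _ hy))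
        (Ideal.mul_mem_right _ _ (Ideal.pow_mem_of_mem _ hy 3 (by norm_num))))
        (Ideal.mul_mem_right _ _ (Ideal.pow_mem_of_mem _ hx 7 (by norm_num)))
    · exact neg_mem (Ideal.mul_mem_right _ _ (Ideal.pow_mem_of_mem _ hy 2 (by norm_num)))
  · rw [hr, Submodule.span_le, Set.singleton_subset_iff]
    apply aux_mem_smul
    intro i
    fin_cases i
    · exact Ideal.pow_mem_of_mem _ hy 2 (by norm_num)
    · exact neg_mem hx
    · exact zero_mem _

end DGPaper
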